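/- Let p ≥ 5 be a prime and let I and J be two p-reduced ideals in ℤ_p[x₁, …, x_d] satisfying I ∩ ℤ_p = J ∩ ℤ_p = (0). If σ is a ℤ_p-algebra automorphism of ℤ_p[x₁, …, x_d], then the set {m ∈ ℤ : σ^m(I) ⊇ J} is the union of a finite number of complete doubly infinite arithmetic progressions, up to the addition of a finite set; that is, it has the two-sided SML property. -/

import Mathlib

/-- A set `S ⊆ ℤ` has the two-sided SML property if it is a finite union of
complete doubly infinite arithmetic progressions `{a*n + b : n ∈ ℤ}` (allowing
`a = 0`, which gives singletons), together with a finite set. -/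
def TwoSidedSML (S : Set ℤ) : Prop :=
  ∃ (P : Finset (ℤ × ℤ)) (F : Set ℤ), F.Finite ∧
    S = (⋃ q ∈ P, {k : ℤ | ∃ n : ℤ, k = q.1 * n + q.2}) ∪ F

/-- A proper ideal `I` of a `ℤ_p`-algebra `A` is `p`-reduced if `p·x ∈ I`
implies `x ∈ I`. -/
def PReduced (p : ℕ) {A : Type*} [CommRing A] (I : Ideal A) : Prop :=
  I ≠ ⊤ ∧ ∀ x : A, (p : A) * x ∈ I → x ∈ I

open Polynomial in
/-- A Strassman-type bound: if `s` is the last index at which the coefficients of `U` leave the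
additive subgroup `H`, then `U` has at most `s` natural number roots. -/
theorem card_le_of_eval_natCast_eq_zero {V : Type*} [CommRing V] [Algebra ℚ V] (H : AddSubgroup V)
    (s : ℕ) (U : V[X]) (hU : ∀ j, s < j → U.coeff j ∈ H) (hs : U.coeff s ∉ H) (T : Finset ℕ)
    (hT : ∀ k ∈ T, U.eval (k : V) = 0) : T.card ≤ s := by
  induction s generalizing U T with
  | zero =>
    rw [Nat.le_zero, Finset.card_eq_zero, Finset.eq_empty_iff_forall_notMem]
    intro k hk
    apply hs
    have h := hT k hk
    rw [eval_eq_sum_range, Finset.sum_range_succ'] at h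
    simp only [pow_zero, mul_one] at h
    rw [eq_neg_of_add_eq_zero_right h]
    refine H.neg_mem (H.sum_mem fun i _ => ?_)
    have h2 := H.nsmul_mem (hU (i + 1) (by omega)) (k ^ (i + 1))
    rwa [nsmul_eq_mul, mul_comm, Nat.cast_pow] at h2
  | succ s ih =>
    rcases T.eq_empty_or_nonempty with rfl | ⟨a, ha⟩
    · simp
    set W := U /ₘ (X - C (a : V)) with hW
    have hrec : ∀ n, W.coeff n = U.coeff (n + 1) + a • W.coeff (n + 1) := fun n => by
      rw [nsmul_eq_mul]; exact coeff_divByMonic_X_sub_C_rec U a n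
    have hmem : ∀ m n, s < n → W.natDegree < n + m → W.coeff n ∈ H := by
      intro m
      induction m with
      | zero =>
        intro n _ h
        rw [coeff_eq_zero_of_natDegree_lt (by omega)]
        exact H.zero_mem
      | succ m ihm =>
        intro n hn h
        rw [hrec]
        exact H.add_mem (hU _ (by omega)) (H.nsmul_mem (ihm _ (by omega) (by omega)) _)
    have hmem' : ∀ n, s < n → W.coeff n ∈ H := fun n hn =>
      hmem (W.natDegree + 1) n hn (by omega)
    have hfac : (X - C (a : V)) * W = U := mul_divByMonic_eq_iff_isRoot.mpr (hT a ha)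
    have hle : (T.erase a).card ≤ s := by
      refine ih W hmem' ?_ _ fun k hk => ?_
      · intro hc
        apply hs
        rw [hrec] at hc
        exact (H.add_mem_cancel_right (H.nsmul_mem (hmem' _ (by omega)) _)).mp hc
      · have hka := (Finset.mem_erase.mp hk).1
        have h := hT k (Finset.mem_erase.mp hk).2
        rw [← hfac, eval_mul, eval_sub, eval_X, eval_C] at h
        have hu : IsUnit ((k : V) - (a : V)) := by
          have := (IsUnit.mk0 ((k : ℚ) - a) (sub_ne_zero.mpr (by exact_mod_cast hka))).map
            (algebraMap ℚ V)
          simpa using this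
        exact hu.mul_right_eq_zero.mp h
    rw [Finset.card_erase_of_mem ha] at hle
    omega

/-- For a prime `q ≥ 3`, the `q`-adic valuation of `i!` is at most `i / 2`. -/
theorem exists_coprime_factorial_mul (q : ℕ) (hq : q.Prime) (hq3 : 3 ≤ q) (i : ℕ) :
    ∃ v b : ℕ, i.factorial = q ^ v * b ∧ b.Coprime q ∧ 2 * v ≤ i := by
  have : Fact q.Prime := ⟨hq⟩
  obtain ⟨b, hb⟩ := pow_padicValNat_dvd (p := q) (n := i.factorial)
  refine ⟨padicValNat q i.factorial, b, hb, ?_, ?_⟩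
  · rw [Nat.coprime_comm, hq.coprime_iff_not_dvd]
    rintro ⟨c, rfl⟩
    apply pow_succ_padicValNat_not_dvd (p := q) i.factorial_ne_zero
    exact ⟨c, by rw [pow_succ, mul_assoc]; exact hb⟩
  · have h := sub_one_mul_padicValNat_factorial (p := q) i
    have : 2 * padicValNat q i.factorial ≤ (q - 1) * padicValNat q i.factorial :=
      Nat.mul_le_mul_right _ (by omega)
    omega

/-- The elements of `V` which lie in `q ^ m M` after multiplication by an integer prime to `q`. -/
def coprimeSaturation {V : Type*} [CommRing V] (M : AddSubgroup V) (q m : ℕ) : AddSubgroup V where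
  carrier := {x | ∃ b : ℕ, b.Coprime q ∧ ∃ y ∈ M, (b : V) * x = (q : V) ^ m * y}
  zero_mem' := ⟨1, by simp, 0, M.zero_mem, by simp⟩
  add_mem' := by
    rintro x x' ⟨b, hb, y, hy, h⟩ ⟨b', hb', y', hy', h'⟩
    refine ⟨b * b', hb.mul_left hb', b' • y + b • y',
      M.add_mem (M.nsmul_mem hy _) (M.nsmul_mem hy' _), ?_⟩
    rw [nsmul_eq_mul, nsmul_eq_mul, Nat.cast_mul]
    linear_combination (b' : V) * h + (b : V) * h'
  neg_mem' := by
    rintro x ⟨b, hb, y, hy, h⟩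
    exact ⟨b, hb, -y, M.neg_mem hy, by linear_combination -h⟩

/-- An element of `M` lying in all the saturations lies in all the `q ^ m M`. -/
theorem exists_eq_pow_mul_of_mem_coprimeSaturation {V : Type*} [CommRing V] {M : AddSubgroup V}
    {q m : ℕ} {x : V} (hxM : x ∈ M) (hx : x ∈ coprimeSaturation M q m) :
    ∃ y ∈ M, x = (q : V) ^ m * y := by
  obtain ⟨b, hb, y, hy, h⟩ := hx
  have hco : IsCoprime (b : ℤ) ((q ^ m : ℕ) : ℤ) :=
    Nat.isCoprime_iff_coprime.mpr (hb.pow_right m)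
  obtain ⟨u, v, huv⟩ := hco
  refine ⟨u • y + v • x, M.add_mem (M.zsmul_mem hy _) (M.zsmul_mem hxM _), ?_⟩
  have huv' : (u : V) * b + v * (q : V) ^ m = 1 := by exact_mod_cast congrArg (Int.cast (R := V)) huv
  rw [zsmul_eq_mul, zsmul_eq_mul]
  linear_combination (u : V) * h - x * huv'

open Polynomial in
/-- A binomial series `k ↦ ∑ i, (k choose i) w i` whose coefficients satisfy `w i ∈ q ^ i M`, with
`q ≥ 3` prime and `M` a `q`-adically separated group, has finitely many zeros in `ℕ` unless all its
coefficients vanish. -/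
theorem eq_zero_of_infinite_zeros {V : Type*} [CommRing V] [Algebra ℚ V]
    (M : AddSubgroup V) (q : ℕ) (hq : q.Prime) (hq3 : 3 ≤ q)
    (hsep : ∀ x : V, (∀ m : ℕ, ∃ y ∈ M, x = (q : V) ^ m * y) → x = 0)
    (w : ℕ → V) (hw : ∀ i, ∃ y ∈ M, w i = (q : V) ^ i * y)
    (hinf : {k : ℕ | ∑ i ∈ Finset.range (k + 1), (k.choose i : V) * w i = 0}.Infinite) (i : ℕ) :
    w i = 0 := by
  by_contra hne
  set t : ℕ → V := fun i => algebraMap ℚ V (1 / i.factorial) * w i with ht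
  have htw : ∀ i, (i.factorial : V) * t i = w i := fun i => by
    have : (i.factorial : V) * algebraMap ℚ V (1 / i.factorial) = 1 := by
      rw [← map_natCast (algebraMap ℚ V), ← map_mul, mul_one_div_cancel, map_one]
      exact_mod_cast i.factorial_ne_zero
    rw [ht, ← mul_assoc, this, one_mul]
  have hwM : ∀ i, w i ∈ M := fun i => by
    obtain ⟨y, hy, h⟩ := hw i
    have := M.nsmul_mem hy (q ^ i)
    rwa [nsmul_eq_mul, Nat.cast_pow, ← h] at this
  have hqu : ∀ n : ℕ, IsUnit ((q : V) ^ n) := fun n => by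
    have := ((IsUnit.mk0 (q : ℚ) (by exact_mod_cast hq.ne_zero)).map (algebraMap ℚ V)).pow n
    simpa using this
  have htend : ∀ m i, 2 * m ≤ i → t i ∈ coprimeSaturation M q m := by
    intro m i hi
    obtain ⟨v, b, hfac, hb, hv⟩ := exists_coprime_factorial_mul q hq hq3 i
    obtain ⟨y, hy, h⟩ := hw i
    refine ⟨b, hb, q ^ (i - v - m) • y, M.nsmul_mem hy _, (hqu v).mul_left_cancel ?_⟩
    have h1 := htw i
    rw [hfac, h] at h1
    push_cast at h1
    rw [nsmul_eq_mul, Nat.cast_pow, ← mul_assoc, h1, ← mul_assoc, ← mul_assoc, ← pow_add, ← pow_add]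
    congr 2
    omega
  obtain ⟨m, hm⟩ : ∃ m, t i ∉ coprimeSaturation M q m := by
    by_contra! hall
    refine hne (hsep _ fun m => exists_eq_pow_mul_of_mem_coprimeSaturation (hwM i) ?_)
    rw [← htw, ← nsmul_eq_mul]
    exact AddSubgroup.nsmul_mem _ (hall m) _
  set H := coprimeSaturation M q m
  obtain ⟨s, hs, hslast⟩ : ∃ s, t s ∉ H ∧ ∀ j, s < j → t j ∈ H := by
    classical
    have hbd : ∀ j, t j ∉ H → j ≤ 2 * m := fun j hj => by
      by_contra! hlt
      exact hj (htend m j hlt.le)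
    refine ⟨Nat.findGreatest (fun j => t j ∉ H) (2 * m),
      Nat.findGreatest_spec (P := fun j => t j ∉ H) (hbd i hm) hm, fun j hj => ?_⟩
    by_contra hc
    exact absurd (Nat.le_findGreatest (P := fun j => t j ∉ H) (hbd j hc) hc) (by omega)
  obtain ⟨T, hTsub, hTcard⟩ := hinf.exists_subset_card_eq (s + 1)
  obtain ⟨B, hB⟩ := T.exists_le
  set N := B + s + 1
  set U : V[X] := ∑ i ∈ Finset.range N, C (t i) * descPochhammer V i
  have hcoeff : ∀ i j, (C (t i) * descPochhammer V i).coeff j =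
      (descPochhammer ℤ i).coeff j • t i := fun i j => by
    rw [coeff_C_mul, ← descPochhammer_map (Int.castRingHom V), coeff_map, zsmul_eq_mul, mul_comm]
    rfl
  have hlow : ∀ i j, i < j → (C (t i) * descPochhammer V i).coeff j = 0 := fun i j hij => by
    rw [hcoeff, coeff_eq_zero_of_natDegree_lt, zero_smul]
    rwa [descPochhammer_natDegree]
  have hcard := card_le_of_eval_natCast_eq_zero H s U ?_ ?_ T ?_
  · omega
  · intro j hj
    rw [finsetSum_coeff]
    refine H.sum_mem fun i _ => ?_
    rcases lt_or_ge s i with h | h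
    · rw [hcoeff]
      exact H.zsmul_mem (hslast i h) _
    · rw [hlow i j (by omega)]
      exact H.zero_mem
  · rw [finsetSum_coeff, ← Finset.add_sum_erase _ _ (Finset.mem_range.mpr (by omega : s < N))]
    rw [H.add_mem_cancel_right]
    · have h1 : (descPochhammer ℤ s).coeff s = 1 := by
        have := monic_descPochhammer ℤ s
        rwa [Monic, leadingCoeff, descPochhammer_natDegree] at this
      rwa [hcoeff, h1, one_smul]
    · refine H.sum_mem fun i hi => ?_
      rcases lt_or_ge s i with h | h
      · rw [hcoeff]
        exact H.zsmul_mem (hslast i h) _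
      · rw [hlow i s (lt_of_le_of_ne h (Finset.mem_erase.mp hi).1)]
        exact H.zero_mem
  · intro k hk
    have hk0 : ∑ i ∈ Finset.range (k + 1), (k.choose i : V) * w i = 0 := hTsub hk
    rw [eval_finsetSum, ← hk0]
    have hkN : k + 1 ≤ N := by have := hB k hk; omega
    have hterm : ∀ i, (C (t i) * descPochhammer V i).eval (k : V) = (k.choose i : V) * w i := by
      intro i
      rw [eval_mul, eval_C, descPochhammer_eval_eq_descFactorial,
        Nat.descFactorial_eq_factorial_mul_choose, ← htw i]
      push_cast
      ring
    rw [← Finset.sum_subset (Finset.range_subset_range.mpr hkN)]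
    · exact Finset.sum_congr rfl fun i _ => hterm i
    · intro i _ hi
      rw [hterm, Nat.choose_eq_zero_of_lt (by simpa using hi)]
      simp

/-- The subring of elements of `L` which are integral over `ℤ` localized at `q`. -/
def integralAt (L : Type*) [CommRing L] (q : ℕ) (hq : q.Prime) : Subring L where
  carrier := {x | ∃ b : ℕ, ¬ q ∣ b ∧ IsIntegral ℤ ((b : L) * x)}
  zero_mem' := ⟨1, hq.not_dvd_one, by simpa using isIntegral_zero⟩
  one_mem' := ⟨1, hq.not_dvd_one, by simpa using isIntegral_one⟩
  add_mem' := by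
    rintro x y ⟨b, hb, hx⟩ ⟨c, hc, hy⟩
    refine ⟨b * c, fun h => (hq.dvd_mul.mp h).elim hb hc, ?_⟩
    have h := ((isIntegral_natCast (R := ℤ) (B := L) c).mul hx).add
      ((isIntegral_natCast (R := ℤ) (B := L) b).mul hy)
    convert h using 1
    push_cast
    ring
  mul_mem' := by
    rintro x y ⟨b, hb, hx⟩ ⟨c, hc, hy⟩
    refine ⟨b * c, fun h => (hq.dvd_mul.mp h).elim hb hc, ?_⟩
    convert hx.mul hy using 1
    push_cast
    ring
  neg_mem' := by
    rintro x ⟨b, hb, hx⟩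
    exact ⟨b, hb, by simpa using hx.neg⟩

/-- The prime `q` is not invertible in `integralAt L q`. -/
theorem natCast_mul_ne_one_of_mem_integralAt {L : Type*} [Field L] [CharZero L] {q : ℕ}
    (hq : q.Prime) {x : L} (hx : x ∈ integralAt L q hq) : (q : L) * x ≠ 1 := by
  obtain ⟨b, hb, hint⟩ := hx
  intro h
  have hq0 : (q : L) ≠ 0 := by exact_mod_cast hq.ne_zero
  have hbq : (b : L) * x = algebraMap ℚ L (b / q) := by
    rw [map_div₀, map_natCast, map_natCast, eq_div_iff hq0]
    linear_combination (b : L) * h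
  rw [hbq, isIntegral_algebraMap_iff (algebraMap ℚ L).injective] at hint
  obtain ⟨n, hn⟩ := IsIntegrallyClosed.isIntegral_iff.mp hint
  rw [eq_div_iff (by exact_mod_cast hq.ne_zero)] at hn
  apply hb
  have h2 : n * q = b := by
    rw [eq_intCast] at hn
    exact_mod_cast hn
  exact Int.natCast_dvd_natCast.mp ⟨n, by rw [← h2, mul_comm]⟩

/-- In a number field, the ring `integralAt L q` is finite modulo `q`. -/
theorem exists_finite_reps_integralAt (L : Type*) [Field L] [NumberField L] {q : ℕ}
    (hq : q.Prime) :
    ∃ F : Set L, F.Finite ∧ ∀ x ∈ integralAt L q hq, ∃ c ∈ F, c ∈ integralAt L q hq ∧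
      ∃ y ∈ integralAt L q hq, x = c + q * y := by
  open NumberField in
  set I : Ideal (𝓞 L) := Ideal.span {(q : 𝓞 L)}
  have hI : I ≠ ⊥ := by
    rw [Ne, Ideal.span_singleton_eq_bot]
    exact_mod_cast hq.ne_zero
  have : Finite (𝓞 L ⧸ I) := Ideal.finiteQuotientOfFreeOfNeBot I hI
  have hO : ∀ z : 𝓞 L, (z : L) ∈ integralAt L q hq := fun z =>
    ⟨1, hq.not_dvd_one, by simpa using RingOfIntegers.isIntegral_coe z⟩
  refine ⟨Set.range fun z : 𝓞 L ⧸ I => ((Quotient.out z : 𝓞 L) : L), Set.finite_range _, ?_⟩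
  rintro x ⟨b, hb, hx⟩
  have hxm : x ∈ integralAt L q hq := ⟨b, hb, hx⟩
  obtain ⟨u, v, huv⟩ := Nat.isCoprime_iff_coprime.mpr ((hq.coprime_iff_not_dvd.mpr hb).symm)
  have huv' : (u : L) * b + v * q = 1 := by exact_mod_cast congrArg (Int.cast (R := L)) huv
  set z : 𝓞 L := ⟨(b : L) * x, hx⟩
  have hz : (z : L) = b * x := rfl
  set c : 𝓞 L := Quotient.out (Ideal.Quotient.mk I (u * z))
  have hc : Ideal.Quotient.mk I (u * z) = Ideal.Quotient.mk I c :=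
    (Ideal.Quotient.mk_out _).symm
  rw [Ideal.Quotient.eq, Ideal.mem_span_singleton'] at hc
  obtain ⟨y, hy⟩ := hc
  have hy' : (y : L) * q = u * z - c := by simpa using congrArg (algebraMap (𝓞 L) L) hy
  refine ⟨c, ⟨_, rfl⟩, hO c, y + v * x,
    Subring.add_mem _ (hO y) (Subring.mul_mem _ (intCast_mem _ v) hxm), ?_⟩
  rw [hz] at hy'
  linear_combination -hy' - x * huv'

/-- A field of finite type over `ℚ` is a number field. -/
theorem numberField_of_finiteType (L : Type*) [Field L] [Algebra ℚ L] [Algebra.FiniteType ℚ L] :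
    NumberField L := by
  have h : Module.Finite ℚ L := finite_of_finite_type_of_isJacobsonRing ℚ L
  exact {
    to_charZero := algebraRat.charZero L
    to_finiteDimensional := by convert! h; exact Subsingleton.elim _ _ }

/-- A `ℚ`-algebra of finite type has a number field quotient killing a given proper ideal. -/
theorem exists_surjective_numberField.{u} {B : Type u} [CommRing B] [Algebra ℚ B]
    [Algebra.FiniteType ℚ B] (I : Ideal B) (hI : I ≠ ⊤) :
    ∃ (L : Type u) (_ : Field L) (_ : NumberField L) (ψ : B →+* L),
      Function.Surjective ψ ∧ ∀ x ∈ I, ψ x = 0 := by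
  obtain ⟨m, hm, hIm⟩ := Ideal.exists_le_maximal I hI
  let _ : Field (B ⧸ m) := Ideal.Quotient.field m
  have : Algebra.FiniteType ℚ (B ⧸ m) :=
    Algebra.FiniteType.of_surjective (Ideal.Quotient.mkₐ ℚ m) (Ideal.Quotient.mkₐ_surjective ℚ m)
  exact ⟨B ⧸ m, inferInstance,
    @numberField_of_finiteType _ _ (Ideal.Quotient.algebra ℚ) this,
    Ideal.Quotient.mk m, Ideal.Quotient.mk_surjective,
    fun x hx => Ideal.Quotient.eq_zero_iff_mem.mpr (hIm hx)⟩

theorem exists_natCast_mul_isIntegral (L : Type*) [Field L] [NumberField L] (x : L) :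
    ∃ b : ℕ, b ≠ 0 ∧ IsIntegral ℤ ((b : L) * x) := by
  have halg : IsAlgebraic ℤ x :=
    (IsFractionRing.isAlgebraic_iff ℤ ℚ L).mpr (Algebra.IsAlgebraic.isAlgebraic x)
  obtain ⟨b, hb, h⟩ := halg.exists_integral_multiple
  rw [Algebra.smul_def, eq_intCast] at h
  refine ⟨b.natAbs, Int.natAbs_ne_zero.mpr hb, ?_⟩
  rw [← Int.cast_natCast]
  rcases abs_choice b with hb' | hb' <;> rw [Int.natCast_natAbs, hb']
  · exact h
  · simpa using h.neg

/-- Given a proper ideal `Q` of a `ℚ`-algebra `E` and a finite set `G ⊆ E`, there are a prime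
`q ≥ 3` and a subring of `E` containing `G` which is finite modulo `q`, and in which `q` is not
invertible modulo the radical of `Q`. -/
theorem exists_prime_subring {E : Type*} [CommRing E] [Algebra ℚ E] (Q : Ideal E) (hQ : Q ≠ ⊤)
    (G : Finset E) :
    ∃ (q : ℕ) (O : Subring E), q.Prime ∧ 3 ≤ q ∧ (↑G : Set E) ⊆ O ∧
      (∃ F : Set E, F.Finite ∧ ∀ x ∈ O, ∃ c ∈ F, ∃ y ∈ O, x = c + q * y) ∧
      ∀ r ∈ O, ∀ j : ℕ, (1 - (q : E) * r) ^ j ∉ Q := by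
  set B := Algebra.adjoin ℚ (↑G : Set E) with hB
  have hBft : Algebra.FiniteType ℚ B :=
    (Subalgebra.fg_iff_finiteType _).mp (Subalgebra.fg_adjoin_finset G)
  set QB : Ideal B := Q.comap B.val
  have hQB : QB ≠ ⊤ := Ideal.comap_ne_top _ hQ
  obtain ⟨L, _, _, ψ, hψs, hψQ⟩ := exists_surjective_numberField QB hQB
  have hden := exists_natCast_mul_isIntegral L
  choose den hden0 hden using hden
  obtain ⟨q, hqle, hq⟩ := Nat.exists_infinite_primes
    (3 + ∑ g : G, den (ψ ⟨g, Algebra.subset_adjoin g.2⟩))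
  set O := ((integralAt L q hq).comap ψ).map B.val.toRingHom
  have hmemO : ∀ x : E, x ∈ O ↔ ∃ y : B, ψ y ∈ integralAt L q hq ∧ (y : E) = x :=
    fun x => Iff.rfl
  refine ⟨q, O, hq, by omega, ?_, ?_, ?_⟩
  · intro g hg
    refine (hmemO g).mpr ⟨⟨g, Algebra.subset_adjoin hg⟩, ⟨den _, fun h => ?_, hden _⟩, rfl⟩
    have h1 := Nat.le_of_dvd (Nat.pos_of_ne_zero (hden0 _)) h
    have h2 := Finset.single_le_sum
      (f := fun g : G => den (ψ ⟨g, Algebra.subset_adjoin g.2⟩)) (fun _ _ => Nat.zero_le _)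
      (Finset.mem_univ (⟨g, hg⟩ : G))
    dsimp only at h2
    omega
  · obtain ⟨F, hF, hrep⟩ := exists_finite_reps_integralAt L hq
    refine ⟨(fun c => ((Function.surjInv hψs c : B) : E)) '' F, hF.image _, ?_⟩
    intro x hx
    obtain ⟨x, hxO, rfl⟩ := (hmemO x).mp hx
    obtain ⟨c, hcF, -, y, hy, hxy⟩ := hrep _ hxO
    have hqq : algebraMap ℚ B q * algebraMap ℚ B (1 / q) = 1 := by
      rw [← map_mul, mul_one_div_cancel (by exact_mod_cast hq.ne_zero), map_one]
    rw [map_natCast] at hqq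
    set z : B := algebraMap ℚ B (1 / q) * (x - Function.surjInv hψs c) with hz
    have hqz : (q : B) * z = x - Function.surjInv hψs c := by
      rw [hz]; linear_combination (x - Function.surjInv hψs c) * hqq
    have hψz : ψ z = y := by
      have h1 := congrArg ψ hqz
      rw [map_mul, map_sub, Function.surjInv_eq hψs, hxy, map_natCast, add_sub_cancel_left] at h1
      exact mul_left_cancel₀ (by exact_mod_cast hq.ne_zero) h1
    refine ⟨_, ⟨c, hcF, rfl⟩, z, (hmemO _).mpr ⟨z, by rwa [hψz], rfl⟩, ?_⟩
    have := congrArg (Subtype.val) hqz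
    push_cast at this
    linear_combination -this
  · intro r hr j hj
    obtain ⟨r, hrO, rfl⟩ := (hmemO r).mp hr
    have h1 : (1 - (q : B) * r) ^ j ∈ QB := by
      simpa [QB] using hj
    have h2 : ψ (1 - (q : B) * r) = 0 := by
      have h3 := hψQ _ h1
      rw [map_pow] at h3
      exact IsReduced.eq_zero _ ⟨j, h3⟩
    apply natCast_mul_ne_one_of_mem_integralAt hq hrO
    rw [map_sub, map_one, map_mul, map_natCast] at h2
    linear_combination -h2

theorem zpow_apply_mem {E : Type*} [CommRing E] (σ : RingAut E) (A : Set E)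
    (h : ∀ x ∈ A, σ x ∈ A) (h' : ∀ x ∈ A, σ⁻¹ x ∈ A) (k : ℤ) {x : E} (hx : x ∈ A) :
    (σ ^ k) x ∈ A := by
  induction k with
  | zero => simpa using hx
  | succ n ih => rw [add_comm, zpow_add, zpow_one]; exact h _ ih
  | pred n ih => rw [sub_eq_neg_add, zpow_add, zpow_neg_one]; exact h' _ ih

theorem apply_mem_adjoin {E : Type*} [CommRing E] (σ : RingAut E) {S : Set E}
    (h : ∀ x ∈ S, σ x ∈ Algebra.adjoin ℤ S) {x : E} (hx : x ∈ Algebra.adjoin ℤ S) :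
    σ x ∈ Algebra.adjoin ℤ S := by
  have : Algebra.adjoin ℤ S ≤ (Algebra.adjoin ℤ S).comap ((σ : E →+* E).toIntAlgHom) :=
    Algebra.adjoin_le h
  exact this hx

/-- If the orbits of the generators of a finitely generated ring meet only finitely many classes
modulo `q`, then some positive power of the automorphism is the identity modulo `q`. -/
theorem exists_pow_apply_eq_add_mul {E : Type*} [CommRing E] (σ : RingAut E) (q : ℕ)
    {S : Set E} (hS : S.Finite) (B : Subring E) (hSB : ∀ x ∈ Algebra.adjoin ℤ S, x ∈ B)
    (h : ∀ x ∈ S, σ x ∈ Algebra.adjoin ℤ S) (h' : ∀ x ∈ S, σ⁻¹ x ∈ Algebra.adjoin ℤ S)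
    {F : Set E} (hF : F.Finite)
    (hrep : ∀ s ∈ S, ∀ k : ℕ, ∃ c ∈ F, ∃ y ∈ B, (σ ^ k) s = c + q * y) :
    ∃ N : ℕ, 0 < N ∧ ∀ x ∈ Algebra.adjoin ℤ S, ∃ y ∈ B, (σ ^ N) x = x + q * y := by
  have hmem : ∀ (k : ℤ) {x : E}, x ∈ Algebra.adjoin ℤ S → (σ ^ k) x ∈ Algebra.adjoin ℤ S :=
    fun k x hx => zpow_apply_mem σ (Algebra.adjoin ℤ S) (fun x => apply_mem_adjoin σ h)
      (fun x => apply_mem_adjoin σ⁻¹ h') k hx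
  have := hS.to_subtype
  have := hF.to_subtype
  have hrep' : ∀ (k : ℕ) (s : S), ∃ c : F, ∃ y ∈ B, (σ ^ k) (s : E) = c + q * y := fun k s => by
    obtain ⟨c, hc, y⟩ := hrep s s.2 k
    exact ⟨⟨c, hc⟩, y⟩
  choose c y hy hcy using hrep'
  obtain ⟨i, j, hij, hc⟩ := Finite.exists_ne_map_eq_of_infinite c
  wlog hlt : i < j generalizing i j
  · exact this j i hij.symm hc.symm (lt_of_le_of_ne (not_lt.mp hlt) hij.symm)
  have key : ∀ x ∈ Algebra.adjoin ℤ S, ∃ y ∈ B, (σ ^ j) x = (σ ^ i) x + q * y := by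
    intro x hx
    have hB : ∀ (k : ℕ) {x : E}, x ∈ Algebra.adjoin ℤ S → (σ ^ k) x ∈ B := fun k x hx => by
      have := hmem k hx
      rw [zpow_natCast] at this
      exact hSB _ this
    induction hx using Algebra.adjoin_induction with
    | mem x hx =>
      refine ⟨y j ⟨x, hx⟩ - y i ⟨x, hx⟩, B.sub_mem (hy _ _) (hy _ _), ?_⟩
      have h1 := hcy i ⟨x, hx⟩
      have h2 := hcy j ⟨x, hx⟩
      rw [hc] at h1
      linear_combination h2 - h1
    | algebraMap r => exact ⟨0, B.zero_mem, by simp⟩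
    | add x y _ _ hx hy =>
      obtain ⟨u, hu, hx⟩ := hx
      obtain ⟨v, hv, hy⟩ := hy
      exact ⟨u + v, B.add_mem hu hv, by rw [map_add, map_add, hx, hy]; ring⟩
    | mul x y hxm hym hx hy =>
      obtain ⟨u, hu, hx⟩ := hx
      obtain ⟨v, hv, hy⟩ := hy
      refine ⟨u * (σ ^ j) y + (σ ^ i) x * v,
        B.add_mem (B.mul_mem hu (hB _ hym)) (B.mul_mem (hB _ hxm) hv), ?_⟩
      rw [map_mul, map_mul]
      linear_combination (σ ^ j) y * hx + (σ ^ i) x * hy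
  refine ⟨j - i, by omega, fun x hx => ?_⟩
  obtain ⟨y, hy, h⟩ := key _ (hmem (-i) hx)
  refine ⟨y, hy, ?_⟩
  rw [← zpow_natCast, ← zpow_natCast, ← RingAut.mul_apply, ← RingAut.mul_apply, ← zpow_add,
    ← zpow_add, add_neg_cancel, zpow_zero, RingAut.one_apply] at h
  rw [← h, ← zpow_natCast, Nat.cast_sub hlt.le, sub_eq_add_neg]

/-- If `q` is not invertible modulo the radical of a primary ideal `Q`, then a finitely generated
ring is `q`-adically separated modulo `Q`. -/
theorem mem_of_forall_pow_mul {E : Type*} [CommRing E] {Q : Ideal E} (hQ : Q.IsPrimary)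
    (S : Finset E) (q : ℕ)
    (hq : ∀ r ∈ Algebra.adjoin ℤ (S : Set E), ∀ j : ℕ, (1 - (q : E) * r) ^ j ∉ Q)
    {x : E} (hx : x ∈ Algebra.adjoin ℤ (S : Set E))
    (h : ∀ m : ℕ, ∃ y ∈ Algebra.adjoin ℤ (S : Set E), x - (q : E) ^ m * y ∈ Q) : x ∈ Q := by
  set A := Algebra.adjoin ℤ (S : Set E)
  have : IsNoetherianRing A := isNoetherianRing_of_fg (Subalgebra.fg_adjoin_finset S)
  set QA : Ideal A := Q.comap A.val
  have hmem : (Ideal.Quotient.mk QA ⟨x, hx⟩ : A ⧸ QA) ∈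
      (⨅ i : ℕ, Ideal.span {(q : A)} ^ i • ⊤ : Submodule A (A ⧸ QA)) := by
    rw [Submodule.mem_iInf]
    intro m
    obtain ⟨y, hy, hxy⟩ := h m
    have : (Ideal.Quotient.mk QA ⟨x, hx⟩ : A ⧸ QA) =
        ((q : A) ^ m) • (Ideal.Quotient.mk QA ⟨y, hy⟩ : A ⧸ QA) := by
      rw [Algebra.smul_def, Ideal.Quotient.algebraMap_eq, ← map_mul, Ideal.Quotient.eq]
      simpa [QA] using hxy
    rw [this]
    exact Submodule.smul_mem_smul (Ideal.pow_mem_pow (Ideal.mem_span_singleton_self _) m) trivial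
  obtain ⟨⟨r, hr⟩, hrx⟩ := (Ideal.mem_iInf_smul_pow_eq_bot_iff _ _).mp hmem
  obtain ⟨s, rfl⟩ := Ideal.mem_span_singleton'.mp hr
  dsimp only at hrx
  rw [Algebra.smul_def, Ideal.Quotient.algebraMap_eq, ← map_mul, Ideal.Quotient.eq] at hrx
  have hrx' : (s : E) * q * x - x ∈ Q := by simpa [QA] using hrx
  have hx' : x * (1 - (q : E) * s) ∈ Q := by
    have := Q.neg_mem hrx'
    convert this using 1
    ring
  rcases (Ideal.isPrimary_iff.mp hQ).2 hx' with hx | ⟨j, hj⟩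
  · exact hx
  · exact absurd hj (hq s s.2 j)

/-- An automorphism which is the identity modulo `q ≥ 3` on a finitely generated ring either
moves an element into a primary ideal finitely often, or always. -/
theorem forall_pow_mem_of_infinite {E : Type*} [CommRing E] [Algebra ℚ E] {Q : Ideal E}
    (hQ : Q.IsPrimary) (S : Finset E) (q : ℕ) (hqp : q.Prime) (hq3 : 3 ≤ q)
    (hq : ∀ r ∈ Algebra.adjoin ℤ (S : Set E), ∀ j : ℕ, (1 - (q : E) * r) ^ j ∉ Q)
    (ρ : RingAut E) (hρ : ∀ x ∈ Algebra.adjoin ℤ (S : Set E),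
      ∃ y ∈ Algebra.adjoin ℤ (S : Set E), ρ x = x + q * y)
    {g : E} (hg : g ∈ Algebra.adjoin ℤ (S : Set E)) (hinf : {k : ℕ | (ρ ^ k) g ∈ Q}.Infinite)
    (k : ℕ) : (ρ ^ k) g ∈ Q := by
  set A := Algebra.adjoin ℤ (S : Set E)
  set M : AddSubgroup (E ⧸ Q) :=
    A.toSubring.toAddSubgroup.map (Ideal.Quotient.mk Q : E →+ E ⧸ Q)
  set φ : Module.End ℤ E := (ρ : E →+* E).toIntAlgHom.toLinearMap
  set δ : Module.End ℤ E := φ - 1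
  have hφ : ∀ (k : ℕ) (x : E), (φ ^ k) x = (ρ ^ k) x := by
    intro k
    induction k with
    | zero => intro x; rfl
    | succ n ih => intro x; rw [pow_succ, pow_succ, Module.End.mul_apply, ih]; rfl
  have hδ : ∀ i : ℕ, ∃ y ∈ A, (δ ^ i) g = (q : E) ^ i * y := by
    intro i
    induction i with
    | zero => exact ⟨g, hg, by simp⟩
    | succ n ih =>
      obtain ⟨y, hy, h⟩ := ih
      obtain ⟨z, hz, hyz⟩ := hρ y hy
      refine ⟨z, hz, ?_⟩
      have h1 : δ ((q : E) ^ n * y) = ρ ((q : E) ^ n * y) - (q : E) ^ n * y := rfl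
      rw [pow_succ', Module.End.mul_apply, h, h1, map_mul, map_pow, map_natCast, hyz]
      ring
  set w : ℕ → E ⧸ Q := fun i => Ideal.Quotient.mk Q ((δ ^ i) g)
  have hu : ∀ k : ℕ, ∑ i ∈ Finset.range (k + 1), (k.choose i : E ⧸ Q) * w i =
      Ideal.Quotient.mk Q ((ρ ^ k) g) := by
    intro k
    have h1 : φ ^ k = ∑ i ∈ Finset.range (k + 1), k.choose i • δ ^ i := by
      have h2 : φ = δ + 1 := by simp [δ]
      rw [h2, (Commute.one_right δ).add_pow]
      exact Finset.sum_congr rfl fun i _ => by simp [nsmul_eq_mul, (Nat.cast_commute _ _).eq]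
    rw [← hφ, h1, LinearMap.sum_apply, map_sum]
    refine Finset.sum_congr rfl fun i _ => ?_
    rw [LinearMap.smul_apply, map_nsmul, nsmul_eq_mul]
  have hw : ∀ i, w i = 0 := by
    refine eq_zero_of_infinite_zeros M q hqp hq3 ?_ w ?_ ?_
    · intro x hx
      obtain ⟨_, ⟨x, hxA, rfl⟩, rfl⟩ := hx 0
      simp only [pow_zero, one_mul] at hx ⊢
      refine Ideal.Quotient.eq_zero_iff_mem.mpr (mem_of_forall_pow_mul hQ S q hq hxA fun m => ?_)
      obtain ⟨_, ⟨y, hyA, rfl⟩, hxy⟩ := hx m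
      refine ⟨y, hyA, Ideal.Quotient.eq.mp ?_⟩
      rw [map_mul, map_pow, map_natCast]
      exact hxy
    · intro i
      obtain ⟨y, hy, h⟩ := hδ i
      refine ⟨Ideal.Quotient.mk Q y, ⟨y, hy, rfl⟩, ?_⟩
      simp only [w, h, map_mul, map_pow, map_natCast]
    · simpa only [hu, Ideal.Quotient.eq_zero_iff_mem] using hinf
  rw [← Ideal.Quotient.eq_zero_iff_mem, ← hu]
  exact Finset.sum_eq_zero fun i _ => by rw [hw, mul_zero]

/-- The integer version of `forall_pow_mem_of_infinite`. -/
theorem finite_or_forall_zpow_mem {E : Type*} [CommRing E] [Algebra ℚ E] {Q : Ideal E}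
    (hQ : Q.IsPrimary) (S : Finset E) (q : ℕ) (hqp : q.Prime) (hq3 : 3 ≤ q)
    (hq : ∀ r ∈ Algebra.adjoin ℤ (S : Set E), ∀ j : ℕ, (1 - (q : E) * r) ^ j ∉ Q)
    (ρ : RingAut E) (hρ : ∀ x ∈ Algebra.adjoin ℤ (S : Set E),
      ∃ y ∈ Algebra.adjoin ℤ (S : Set E), ρ x = x + q * y)
    (hρ' : ∀ x ∈ Algebra.adjoin ℤ (S : Set E), ρ⁻¹ x ∈ Algebra.adjoin ℤ (S : Set E))
    {g : E} (hg : g ∈ Algebra.adjoin ℤ (S : Set E)) :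
    {k : ℤ | (ρ ^ k) g ∈ Q}.Finite ∨ ∀ k : ℤ, (ρ ^ k) g ∈ Q := by
  set A := Algebra.adjoin ℤ (S : Set E)
  have hmem : ∀ (k : ℤ) {x : E}, x ∈ A → (ρ ^ k) x ∈ A := fun k x hx => by
    refine zpow_apply_mem ρ A (fun x hx => ?_) hρ' k hx
    obtain ⟨y, hy, h⟩ := hρ x hx
    rw [h]
    exact A.add_mem hx (A.mul_mem (natCast_mem A q) hy)
  have hρinv : ∀ x ∈ A, ∃ y ∈ A, ρ⁻¹ x = x + q * y := by
    intro x hx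
    obtain ⟨y, hy, h⟩ := hρ _ (hρ' x hx)
    refine ⟨-y, A.neg_mem hy, ?_⟩
    rw [← RingAut.mul_apply, mul_inv_cancel, RingAut.one_apply] at h
    linear_combination -h
  have hinf : ∀ T : Set ℕ, (∀ N : ℕ, ∃ n ∈ T, N < n) → T.Infinite := fun T hT =>
    Set.infinite_of_forall_exists_gt hT
  by_cases hab : BddAbove {k : ℤ | (ρ ^ k) g ∈ Q}
  · by_cases hbe : BddBelow {k : ℤ | (ρ ^ k) g ∈ Q}
    · exact Or.inl (hbe.finite_of_bddAbove hab)
    · refine Or.inr fun k => ?_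
      refine forall_pow_mem_of_infinite hQ S q hqp hq3 hq ρ⁻¹ hρinv (hmem k hg)
        (hinf _ fun N => ?_) 0
      rw [not_bddBelow_iff] at hbe
      obtain ⟨m, hm, hlt⟩ := hbe (k - N)
      refine ⟨(k - m).toNat, ?_, by omega⟩
      rw [Set.mem_ofPred_eq, ← zpow_natCast, Int.toNat_of_nonneg (by omega), inv_zpow',
        ← RingAut.mul_apply, ← zpow_add]
      rwa [neg_sub, sub_add_cancel]
  · refine Or.inr fun k => ?_
    refine forall_pow_mem_of_infinite hQ S q hqp hq3 hq ρ hρ (hmem k hg)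
      (hinf _ fun N => ?_) 0
    rw [not_bddAbove_iff] at hab
    obtain ⟨m, hm, hlt⟩ := hab (k + N)
    refine ⟨(m - k).toNat, ?_, by omega⟩
    rw [Set.mem_ofPred_eq, ← zpow_natCast, Int.toNat_of_nonneg (by omega),
      ← RingAut.mul_apply, ← zpow_add]
    rwa [sub_add_cancel]

/-- A set of integers which, in every residue class modulo some positive `e`, is finite or
everything. -/
def FiniteOrFullModulo (S : Set ℤ) : Prop :=
  ∃ e : ℤ, 0 < e ∧ ∀ r : ℤ, {k : ℤ | r + e * k ∈ S}.Finite ∨ ∀ k : ℤ, r + e * k ∈ S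

theorem FiniteOrFullModulo.univ : FiniteOrFullModulo Set.univ :=
  ⟨1, one_pos, fun _ => Or.inr fun _ => trivial⟩

theorem FiniteOrFullModulo.inter {S T : Set ℤ} (hS : FiniteOrFullModulo S)
    (hT : FiniteOrFullModulo T) : FiniteOrFullModulo (S ∩ T) := by
  obtain ⟨e, he, hS⟩ := hS
  obtain ⟨e', he', hT⟩ := hT
  refine ⟨e * e', mul_pos he he', fun r => ?_⟩
  rcases hS r with h | h
  · refine Or.inl ((h.preimage (f := fun k => e' * k)
      (mul_right_injective₀ he'.ne').injOn).subset fun k hk => ?_)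
    have := hk.1
    rwa [mul_assoc] at this
  rcases hT r with h' | h'
  · refine Or.inl ((h'.preimage (f := fun k => e * k)
      (mul_right_injective₀ he.ne').injOn).subset fun k hk => ?_)
    have := hk.2
    rwa [mul_comm e, mul_assoc] at this
  · refine Or.inr fun k => ⟨?_, ?_⟩
    · rw [mul_assoc]; exact h _
    · rw [mul_comm e, mul_assoc]; exact h' _

theorem FiniteOrFullModulo.biInter {ι : Type*} (s : Finset ι) (S : ι → Set ℤ)
    (h : ∀ i ∈ s, FiniteOrFullModulo (S i)) : FiniteOrFullModulo (⋂ i ∈ s, S i) := by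
  classical
  induction s using Finset.induction_on with
  | empty => simpa using FiniteOrFullModulo.univ
  | insert a s ha ih =>
    rw [Finset.set_biInter_insert]
    exact (h a (Finset.mem_insert_self a s)).inter
      (ih fun i hi => h i (Finset.mem_insert_of_mem hi))

theorem FiniteOrFullModulo.twoSidedSML {S : Set ℤ} (hS : FiniteOrFullModulo S) :
    TwoSidedSML S := by
  classical
  obtain ⟨e, he, hS⟩ := hS
  refine ⟨((Finset.Ico 0 e).filter fun r => ∀ k : ℤ, r + e * k ∈ S).image fun r => (e, r),
    ⋃ r ∈ (Finset.Ico 0 e).filter fun r => ¬ ∀ k : ℤ, r + e * k ∈ S,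
      (fun k => r + e * k) '' {k : ℤ | r + e * k ∈ S}, ?_, ?_⟩
  · refine Set.Finite.biUnion (Finset.finite_toSet _) fun r hr => Set.Finite.image _ ?_
    exact (hS r).resolve_right (Finset.mem_filter.mp hr).2
  · ext m
    simp only [Set.mem_union, Set.mem_iUnion, Finset.mem_image, Finset.mem_filter,
      Finset.mem_Ico, Set.mem_ofPred_eq, Set.mem_image, exists_prop]
    have hm : m % e + e * (m / e) = m := Int.emod_add_mul_ediv m e
    constructor
    · intro hmS
      by_cases hfull : ∀ k : ℤ, m % e + e * k ∈ S
      · exact Or.inl ⟨_, ⟨m % e, ⟨⟨Int.emod_nonneg _ he.ne', Int.emod_lt_of_pos _ he⟩, hfull⟩,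
          rfl⟩, m / e, by dsimp only; omega⟩
      · exact Or.inr ⟨m % e, ⟨⟨Int.emod_nonneg _ he.ne', Int.emod_lt_of_pos _ he⟩, hfull⟩,
          m / e, by rwa [hm], hm⟩
    · rintro (⟨_, ⟨r, ⟨_, hr⟩, rfl⟩, n, rfl⟩ | ⟨r, _, k, hk, rfl⟩)
      · rw [add_comm]; exact hr n
      · exact hk

theorem mem_subring_of_mem_adjoin {E : Type*} [CommRing E] {S : Set E} {B : Subring E}
    (h : S ⊆ B) {x : E} (hx : x ∈ Algebra.adjoin ℤ S) : x ∈ B :=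
  Algebra.adjoin_le (S := subalgebraOfSubring B) h hx

/-- The return-time set of a finitely generated subring of a `ℚ`-algebra to a primary ideal. -/
theorem finiteOrFullModulo_of_isPrimary {E : Type*} [CommRing E] [Algebra ℚ E] {Q : Ideal E}
    (hQ : Q.IsPrimary) (σ : RingAut E) (G : Finset E)
    (hσ : ∀ x ∈ G, σ x ∈ Algebra.adjoin ℤ (G : Set E))
    (hσ' : ∀ x ∈ G, σ⁻¹ x ∈ Algebra.adjoin ℤ (G : Set E))
    {f : E} (hf : f ∈ Algebra.adjoin ℤ (G : Set E)) :
    FiniteOrFullModulo {k : ℤ | (σ ^ k) f ∈ Q} := by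
  classical
  obtain ⟨q, O, hqp, hq3, hGO, ⟨F, hF, hFrep⟩, hQO⟩ :=
    exists_prime_subring Q (Ideal.isPrimary_iff.mp hQ).1 G
  set P := Algebra.adjoin ℤ (G : Set E) with hP
  have hPO : ∀ x ∈ P, x ∈ O := fun x hx => mem_subring_of_mem_adjoin hGO hx
  have hσP : ∀ (k : ℤ) {x : E}, x ∈ P → (σ ^ k) x ∈ P := fun k x hx =>
    zpow_apply_mem σ P (fun x hx => apply_mem_adjoin σ hσ hx)
      (fun x hx => apply_mem_adjoin σ⁻¹ hσ' hx) k hx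
  have hσPn : ∀ (k : ℕ) {x : E}, x ∈ P → (σ ^ k) x ∈ P := fun k x hx => by
    have := hσP k hx
    rwa [zpow_natCast] at this
  obtain ⟨N, hN0, hN⟩ := exists_pow_apply_eq_add_mul σ q G.finite_toSet O hPO hσ hσ' hF
    fun s hs k => hFrep _ (hPO _ (hσPn k (Algebra.subset_adjoin hs)))
  set τ := σ ^ N with hτ
  obtain ⟨c, hqc⟩ : ∃ c : E, (q : E) * c = 1 := by
    refine ⟨algebraMap ℚ E (1 / q), ?_⟩
    rw [← map_natCast (algebraMap ℚ E), ← map_mul,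
      mul_one_div_cancel (by exact_mod_cast hqp.ne_zero), map_one]
  have hτP' : ∀ {x : E}, x ∈ P → τ⁻¹ x ∈ P := fun hx => by
    have := hσP (-N) hx
    rwa [zpow_neg, zpow_natCast] at this
  -- The dilatation of `P`, generated by the elements of `O` with `q`-multiple in `P`.
  set Γ : Set E := {x | (q : E) * x ∈ P ∧ x ∈ O} with hΓ
  have hPΓ : ∀ x ∈ P, x ∈ Γ := fun x hx => ⟨P.mul_mem (natCast_mem P q) hx, hPO x hx⟩
  have hτΓ : ∀ x ∈ Γ, τ x ∈ Γ := by
    rintro x ⟨hx, hxO⟩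
    obtain ⟨y, hy, h⟩ := hN _ hx
    rw [map_mul, map_natCast] at h
    refine ⟨by have := hσPn N hx; rwa [← hτ, map_mul, map_natCast] at this, ?_⟩
    have : τ x = x + y := by linear_combination c * h - (τ x - x - y) * hqc
    rw [this]
    exact O.add_mem hxO hy
  have hτΓ' : ∀ x ∈ Γ, τ⁻¹ x ∈ Γ := by
    rintro x ⟨hx, hxO⟩
    obtain ⟨y, hy, h⟩ := hN _ (hτP' hx)
    rw [← RingAut.mul_apply, mul_inv_cancel, RingAut.one_apply, map_mul, map_natCast] at h
    refine ⟨by have := hτP' hx; rwa [map_mul, map_natCast] at this, ?_⟩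
    have : τ⁻¹ x = x - y := by linear_combination -c * h - (τ⁻¹ x - x + y) * hqc
    rw [this]
    exact O.sub_mem hxO hy
  have : IsNoetherianRing P := isNoetherianRing_of_fg (Subalgebra.fg_adjoin_finset G)
  set n : Ideal P := (Ideal.span {(q : O)}).comap
    ((algebraMap P E).codRestrict O fun x => hPO x x.2) with hn
  have hmemn : ∀ a : P, a ∈ n ↔ c * a ∈ O := by
    intro a
    rw [hn, Ideal.mem_comap, Ideal.mem_span_singleton']
    constructor
    · rintro ⟨y, hy⟩
      have hy' : (y : E) * q = a := congrArg Subtype.val hy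
      rw [← hy', show c * ((y : E) * q) = y by linear_combination y * hqc]
      exact y.2
    · intro h
      refine ⟨⟨_, h⟩, Subtype.ext ?_⟩
      change c * (a : E) * q = a
      linear_combination (a : E) * hqc
  obtain ⟨t, ht⟩ : n.FG := IsNoetherian.noetherian n
  set S : Finset E := G ∪ t.image fun a : P => c * (a : E) with hS
  set P' := Algebra.adjoin ℤ (S : Set E) with hP'
  have hSΓ : ∀ x ∈ S, x ∈ Γ := by
    intro x hx
    rcases Finset.mem_union.mp hx with hx | hx
    · exact hPΓ x (Algebra.subset_adjoin hx)
    · obtain ⟨a, ha, rfl⟩ := Finset.mem_image.mp hx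
      refine ⟨?_, (hmemn a).mp (ht ▸ Submodule.subset_span ha)⟩
      rw [← mul_assoc, hqc, one_mul]
      exact a.2
  have hPP' : P ≤ P' := Algebra.adjoin_mono (by simp [hS])
  have hspan : ∀ x ∈ Γ, ∃ u : P → P, x = ∑ a ∈ t, (u a : E) * (c * a) := by
    rintro x ⟨hx, hxO⟩
    have hxn : (⟨_, hx⟩ : P) ∈ n := by
      rw [hmemn]
      rwa [← mul_assoc, mul_comm c, hqc, one_mul]
    rw [← ht] at hxn
    obtain ⟨u, -, hu⟩ := Submodule.mem_span_finset.mp hxn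
    refine ⟨u, ?_⟩
    have h1 : ∑ a ∈ t, (u a : E) * a = q * x := by
      have := congrArg (algebraMap P E) hu
      simpa [map_sum] using this
    calc x = c * (q * x) := by linear_combination -x * hqc
      _ = _ := by
        rw [← h1, Finset.mul_sum]
        exact Finset.sum_congr rfl fun a _ => by ring
  have htP' : ∀ a ∈ t, c * (a : E) ∈ P' := fun a ha =>
    Algebra.subset_adjoin (Finset.mem_union_right _ (Finset.mem_image_of_mem _ ha))
  have hΓP' : ∀ x ∈ Γ, x ∈ P' := by
    intro x hx
    obtain ⟨u, rfl⟩ := hspan x hx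
    exact P'.sum_mem fun a ha => P'.mul_mem (hPP' (u a).2) (htP' a ha)
  have hP'O : ∀ x ∈ P', x ∈ O := fun x hx =>
    mem_subring_of_mem_adjoin (fun x hx => (hSΓ x hx).2) hx
  have hFP : ∃ F₀ : Set E, F₀.Finite ∧ ∀ x ∈ P, ∃ b ∈ F₀, ∃ y ∈ Γ, x = b + q * y := by
    have hch : ∀ b : E, ∃ b' : E, (∃ x ∈ P, ∃ y ∈ O, x = b + q * y) →
        b' ∈ P ∧ ∃ y ∈ O, b' = b + q * y := by
      intro b
      by_cases hb : ∃ x ∈ P, ∃ y ∈ O, x = b + q * y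
      · exact ⟨hb.choose, fun _ => hb.choose_spec⟩
      · exact ⟨0, fun h => absurd h hb⟩
    choose r hr using hch
    refine ⟨r '' F, hF.image r, fun x hx => ?_⟩
    obtain ⟨b, hb, y, hy, hxy⟩ := hFrep x (hPO x hx)
    obtain ⟨hbP, z, hz, hbz⟩ := hr b ⟨x, hx, y, hy, hxy⟩
    refine ⟨r b, ⟨b, hb, rfl⟩, y - z, ⟨?_, O.sub_mem hy hz⟩, ?_⟩
    · rw [show (q : E) * (y - z) = x - r b by linear_combination hbz - hxy]
      exact P.sub_mem hx hbP
    · linear_combination hxy - hbz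
  obtain ⟨F₀, hF₀, hF₀rep⟩ := hFP
  have hΓfin : ∃ F' : Set E, F'.Finite ∧ ∀ x ∈ Γ, ∃ b ∈ F', ∃ y ∈ P', x = b + q * y := by
    have := hF₀.to_subtype
    refine ⟨Set.range fun v : t → F₀ => ∑ a : t, (v a : E) * (c * (a : P)), Set.finite_range _,
      fun x hx => ?_⟩
    obtain ⟨u, rfl⟩ := hspan x hx
    have hu : ∀ a : P, ∃ b : F₀, ∃ y ∈ Γ, (u a : E) = b + q * y := fun a => by
      obtain ⟨b, hb, y⟩ := hF₀rep _ (u a).2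
      exact ⟨⟨b, hb⟩, y⟩
    choose v y hy huv using hu
    refine ⟨_, ⟨fun a => v a, rfl⟩, ∑ a ∈ t, y a * (c * a),
      P'.sum_mem fun a ha => P'.mul_mem (hΓP' _ (hy a)) (htP' a ha), ?_⟩
    dsimp only
    rw [Finset.univ_eq_attach, Finset.sum_attach t fun a => (v a : E) * (c * (a : E)),
      Finset.mul_sum, ← Finset.sum_add_distrib]
    exact Finset.sum_congr rfl fun a _ => by rw [huv]; ring
  obtain ⟨F', hF', hF'rep⟩ := hΓfin
  have hτΓpow : ∀ (k : ℕ) {x : E}, x ∈ Γ → (τ ^ k) x ∈ Γ := fun k x hx => by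
    have := zpow_apply_mem τ Γ hτΓ hτΓ' k hx
    rwa [zpow_natCast] at this
  have hτS' : ∀ x ∈ (S : Set E), τ⁻¹ x ∈ P' := fun x hx => hΓP' _ (hτΓ' x (hSΓ x hx))
  obtain ⟨M, hM0, hM⟩ := exists_pow_apply_eq_add_mul τ q S.finite_toSet P'.toSubring
    (fun x hx => hx) (fun x hx => hΓP' _ (hτΓ x (hSΓ x hx))) hτS' hF'
    fun s hs k => hF'rep _ (hτΓpow k (hSΓ s hs))
  have hρ' : ∀ x ∈ P', (τ ^ M)⁻¹ x ∈ P' := fun x hx => by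
    have := zpow_apply_mem τ P' (fun x => apply_mem_adjoin τ fun x hx => hΓP' _ (hτΓ x (hSΓ x hx)))
      (fun x => apply_mem_adjoin τ⁻¹ hτS') (-M) hx
    rwa [zpow_neg, zpow_natCast] at this
  refine ⟨(N : ℤ) * M, by positivity, fun r => ?_⟩
  have h := finite_or_forall_zpow_mem hQ S q hqp hq3 (fun r hr => hQO r (hP'O r hr)) (τ ^ M) hM hρ'
    (hPP' (hσP r hf))
  have hpow : ∀ k : ℤ, (σ ^ (r + (N : ℤ) * M * k)) f = ((τ ^ M) ^ k) ((σ ^ r) f) := fun k => by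
    rw [← RingAut.mul_apply, hτ, ← pow_mul, ← zpow_natCast, ← zpow_mul, ← zpow_add, add_comm]
    push_cast
    rfl
  simpa only [Set.mem_ofPred_eq, hpow] using h

/-- A polynomial is in the subring generated by the variables and its coefficients. -/
theorem mem_adjoin_of_coeff_mem {K ι : Type*} [CommRing K] {S : Set (MvPolynomial ι K)}
    (hX : ∀ i, MvPolynomial.X i ∈ S) (f : MvPolynomial ι K)
    (hf : ∀ m ∈ f.support, MvPolynomial.C (f.coeff m) ∈ S) : f ∈ Algebra.adjoin ℤ S := by
  rw [f.as_sum]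
  refine Subalgebra.sum_mem _ fun m hm => ?_
  rw [MvPolynomial.monomial_eq]
  exact Subalgebra.mul_mem _ (Algebra.subset_adjoin (hf m hm))
    (Subalgebra.prod_mem _ fun i _ => Subalgebra.pow_mem _ (Algebra.subset_adjoin (hX i)) _)

/-- An algebra automorphism of a polynomial ring preserves a finitely generated subring
containing any given finite set of polynomials. -/
theorem exists_finset_adjoin_stable {K ι : Type*} [CommRing K] [Fintype ι]
    (σ : MvPolynomial ι K ≃ₐ[K] MvPolynomial ι K) (A : Finset (MvPolynomial ι K)) :
    ∃ G : Finset (MvPolynomial ι K), (∀ f ∈ A, f ∈ Algebra.adjoin ℤ (G : Set (MvPolynomial ι K))) ∧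
      ∀ x ∈ G, σ x ∈ Algebra.adjoin ℤ (G : Set (MvPolynomial ι K)) ∧
        σ⁻¹ x ∈ Algebra.adjoin ℤ (G : Set (MvPolynomial ι K)) := by
  classical
  let B : Finset (MvPolynomial ι K) := A ∪ Finset.univ.image (fun i => σ (MvPolynomial.X i)) ∪
    Finset.univ.image fun i => σ⁻¹ (MvPolynomial.X i)
  let G : Finset (MvPolynomial ι K) := Finset.univ.image MvPolynomial.X ∪
    B.biUnion fun f => f.support.image fun m => MvPolynomial.C (f.coeff m)
  have hB : ∀ f ∈ B, f ∈ Algebra.adjoin ℤ (G : Set (MvPolynomial ι K)) := fun f hf =>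
    mem_adjoin_of_coeff_mem (fun i => by simp [G]) f fun m hm => by
      refine Finset.mem_union_right _ (Finset.mem_biUnion.mpr ⟨f, hf, ?_⟩)
      exact Finset.mem_image_of_mem (fun m => MvPolynomial.C (f.coeff m)) hm
  refine ⟨G, fun f hf => hB f (by simp [B, hf]), fun x hx => ?_⟩
  rcases Finset.mem_union.mp hx with h | h
  · obtain ⟨i, -, rfl⟩ := Finset.mem_image.mp h
    exact ⟨hB _ (by simp [B]), hB _ (by simp [B])⟩
  · obtain ⟨f, -, h⟩ := Finset.mem_biUnion.mp h
    obtain ⟨m, -, rfl⟩ := Finset.mem_image.mp h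
    have hC : ∀ (τ : MvPolynomial ι K ≃ₐ[K] MvPolynomial ι K) (c : K),
        τ (MvPolynomial.C c) = MvPolynomial.C c := fun τ c => τ.commutes c
    rw [hC, hC]
    exact ⟨Algebra.subset_adjoin hx, Algebra.subset_adjoin hx⟩

/-- The return-time set of a finitely generated subring of a Noetherian `ℚ`-algebra to an ideal. -/
theorem finiteOrFullModulo_of_ideal {E : Type*} [CommRing E] [IsNoetherianRing E] [Algebra ℚ E]
    (I : Ideal E) (σ : RingAut E) (G : Finset E)
    (hσ : ∀ x ∈ G, σ x ∈ Algebra.adjoin ℤ (G : Set E))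
    (hσ' : ∀ x ∈ G, σ⁻¹ x ∈ Algebra.adjoin ℤ (G : Set E))
    {f : E} (hf : f ∈ Algebra.adjoin ℤ (G : Set E)) :
    FiniteOrFullModulo {k : ℤ | (σ ^ k) f ∈ I} := by
  classical
  obtain ⟨s, hs, hprim⟩ := Submodule.isLasker E E I
  have h := FiniteOrFullModulo.biInter s (fun Q => {k : ℤ | (σ ^ k) f ∈ Q})
    fun Q hQ => finiteOrFullModulo_of_isPrimary (hprim hQ) σ G hσ hσ' hf
  convert h using 1
  ext k
  simp [← hs]

/-- Nonzero constants can be cancelled modulo a `p`-reduced ideal. -/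
theorem PReduced.mem_of_C_mul_mem {p d : ℕ} [Fact p.Prime]
    {I : Ideal (MvPolynomial (Fin d) ℤ_[p])} (hI : PReduced p I) {c : ℤ_[p]} (hc : c ≠ 0)
    {x : MvPolynomial (Fin d) ℤ_[p]} (h : MvPolynomial.C c * x ∈ I) : x ∈ I := by
  have hpow : ∀ n : ℕ, (p : MvPolynomial (Fin d) ℤ_[p]) ^ n * x ∈ I → x ∈ I := by
    intro n
    induction n with
    | zero => simp
    | succ n ih =>
      intro h
      rw [pow_succ', mul_assoc] at h
      exact ih (hI.2 _ h)
  refine hpow c.valuation ?_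
  rw [PadicInt.unitCoeff_spec hc, map_mul, map_pow, map_natCast, mul_assoc] at h
  have := I.mul_mem_left
    (MvPolynomial.C (((PadicInt.unitCoeff hc)⁻¹ : ℤ_[p]ˣ) : ℤ_[p])) h
  rwa [← mul_assoc, ← map_mul, Units.inv_mul, map_one, one_mul] at this

/-- The return-time set of a polynomial to a `p`-reduced ideal. -/
theorem PReduced.finiteOrFullModulo {p d : ℕ} [Fact p.Prime]
    {I : Ideal (MvPolynomial (Fin d) ℤ_[p])} (hI : PReduced p I)
    (σ : MvPolynomial (Fin d) ℤ_[p] ≃ₐ[ℤ_[p]] MvPolynomial (Fin d) ℤ_[p])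
    (f : MvPolynomial (Fin d) ℤ_[p]) :
    FiniteOrFullModulo {k : ℤ | (σ ^ k) f ∈ I} := by
  classical
  let R := MvPolynomial (Fin d) ℤ_[p]
  let E := MvPolynomial (Fin d) ℚ_[p]
  let _ : Algebra R E := MvPolynomial.algebraMvPolynomial
  let M : Submonoid R := (nonZeroDivisors ℤ_[p]).map MvPolynomial.C
  have hloc : IsLocalization M E := MvPolynomial.isLocalization (nonZeroDivisors ℤ_[p]) ℚ_[p]
  have hC : ∀ (τ : R ≃ₐ[ℤ_[p]] R) (c : ℤ_[p]),
      τ (MvPolynomial.C c) = MvPolynomial.C c := fun τ c => τ.commutes c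
  have hM : M.map σ.toRingEquiv.toMonoidHom = M := by
    ext x
    constructor
    · rintro ⟨_, ⟨c, hc, rfl⟩, rfl⟩
      exact ⟨c, hc, (hC σ c).symm⟩
    · rintro ⟨c, hc, rfl⟩
      exact ⟨_, ⟨c, hc, rfl⟩, hC σ c⟩
  let τ : RingAut E := IsLocalization.ringEquivOfRingEquiv E E σ.toRingEquiv hM
  have hτ : ∀ x : R, τ (algebraMap R E x) = algebraMap R E (σ x) := fun x =>
    IsLocalization.ringEquivOfRingEquiv_eq hM x
  have hτ' : ∀ x : R, τ⁻¹ (algebraMap R E x) = algebraMap R E (σ⁻¹ x) := fun x => by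
    apply τ.injective
    rw [hτ, ← RingAut.mul_apply, mul_inv_cancel, RingAut.one_apply, ← AlgEquiv.mul_apply,
      mul_inv_cancel, AlgEquiv.one_apply]
  have hτk : ∀ (k : ℤ) (x : R), (τ ^ k) (algebraMap R E x) = algebraMap R E ((σ ^ k) x) := by
    intro k
    induction k with
    | zero => simp
    | succ n ih =>
      intro x
      rw [zpow_add_one, zpow_add_one, RingAut.mul_apply, hτ, ih, AlgEquiv.mul_apply]
    | pred n ih =>
      intro x
      rw [zpow_sub_one, zpow_sub_one, RingAut.mul_apply, hτ', ih, AlgEquiv.mul_apply]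
  have hinj : Function.Injective (algebraMap R E) :=
    MvPolynomial.map_injective _ (IsFractionRing.injective ℤ_[p] ℚ_[p])
  have hmem : ∀ x : R, algebraMap R E x ∈ I.map (algebraMap R E) ↔ x ∈ I := by
    refine fun x => ⟨fun h => ?_, Ideal.mem_map_of_mem _⟩
    obtain ⟨⟨a, ⟨_, c, hc, rfl⟩⟩, h⟩ := (IsLocalization.mem_map_algebraMap_iff M E).mp h
    refine hI.mem_of_C_mul_mem (nonZeroDivisors.ne_zero hc) ?_
    rw [← map_mul] at h
    rw [mul_comm]
    exact (hinj h).symm ▸ a.2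
  obtain ⟨G, hG, hGσ⟩ := exists_finset_adjoin_stable σ {f}
  have hadj : ∀ x ∈ Algebra.adjoin ℤ (G : Set R), algebraMap R E x ∈
      Algebra.adjoin ℤ ((G.image (algebraMap R E) : Finset E) : Set E) := by
    intro x hx
    refine mem_subring_of_mem_adjoin (B := (Algebra.adjoin ℤ
      ((G.image (algebraMap R E) : Finset E) : Set E)).toSubring.comap (algebraMap R E))
      (fun y hy => ?_) hx
    exact Algebra.subset_adjoin (Finset.mem_coe.mpr (Finset.mem_image_of_mem _ hy))
  have h := finiteOrFullModulo_of_ideal (I.map (algebraMap R E)) τ (G.image (algebraMap R E))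
    (fun y hy => by
      obtain ⟨x, hx, rfl⟩ := Finset.mem_image.mp hy
      rw [hτ]
      exact hadj _ (hGσ x hx).1)
    (fun y hy => by
      obtain ⟨x, hx, rfl⟩ := Finset.mem_image.mp hy
      rw [hτ']
      exact hadj _ (hGσ x hx).2)
    (hadj f (hG f (Finset.mem_singleton_self f)))
  simpa only [hτk, hmem] using h

/-- **Theorem 4.5.** Let `p ≥ 5` be prime and `I`, `J` two `p`-reduced ideals
in `ℤ_p[x₁, …, x_d]` with `I ∩ ℤ_p = J ∩ ℤ_p = (0)` (no nonzero constants).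
If `σ` is a `ℤ_p`-algebra automorphism of `ℤ_p[x₁, …, x_d]`, then
`{m ∈ ℤ : σᵐ(I) ⊇ J}` is a finite union of complete doubly infinite arithmetic
progressions, up to the addition of a finite set, i.e. it has the two-sided SML
property. -/
theorem stmt16 (p : ℕ) [Fact p.Prime] (hp : 5 ≤ p) (d : ℕ)
    (I J : Ideal (MvPolynomial (Fin d) ℤ_[p]))
    (hI : PReduced p I) (hJ : PReduced p J)
    (hI0 : ∀ c : ℤ_[p], MvPolynomial.C c ∈ I → c = 0)
    (hJ0 : ∀ c : ℤ_[p], MvPolynomial.C c ∈ J → c = 0)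
    (σ : MvPolynomial (Fin d) ℤ_[p] ≃ₐ[ℤ_[p]] MvPolynomial (Fin d) ℤ_[p]) :
    TwoSidedSML {m : ℤ |
      J ≤ I.map (σ ^ m : MvPolynomial (Fin d) ℤ_[p] ≃ₐ[ℤ_[p]] MvPolynomial (Fin d) ℤ_[p])} := by
  classical
  obtain ⟨A, hA⟩ : J.FG := IsNoetherian.noetherian J
  have h := FiniteOrFullModulo.biInter A (fun f => {k : ℤ | ((σ⁻¹) ^ k) f ∈ I})
    fun f _ => hI.finiteOrFullModulo σ⁻¹ f
  convert h.twoSidedSML using 1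
  ext m
  have hmap : ∀ x, x ∈ I.map (σ ^ m : MvPolynomial (Fin d) ℤ_[p] ≃ₐ[ℤ_[p]]
      MvPolynomial (Fin d) ℤ_[p]) ↔ ((σ⁻¹) ^ m) x ∈ I := by
    intro x
    rw [inv_zpow]
    have hσ : (σ ^ m) ((σ ^ m)⁻¹ x) = x := by
      rw [← AlgEquiv.mul_apply, mul_inv_cancel, AlgEquiv.one_apply]
    constructor
    · intro h
      obtain ⟨y, hy, rfl⟩ := (Ideal.mem_map_of_equiv (σ ^ m) x).mp h
      rwa [← AlgEquiv.mul_apply, inv_mul_cancel, AlgEquiv.one_apply]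
    · intro h
      rw [← hσ]
      exact Ideal.mem_map_of_mem _ h
  rw [Set.mem_ofPred_eq, ← hA, Ideal.span, Submodule.span_le, Set.mem_iInter₂]
  exact forall₂_congr fun f _ => hmap f
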